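/- arXiv:1807.08384 — 8 statements merged into one kernel-verified Lean document; each statement's English description precedes it below -/
import Mathlib

section
/- Let K and L be finite lattices such that K is a subposet of L (there is an order embedding f : K → L). Then the number of join-reducible elements of L is at least the number of join-reducible elements of K, i.e. |Jred(L)| ≥ |Jred(K)|; dually, |Mred(L)| ≥ |Mred(K)|. -/
theorem not_isMin_and_not_supIrred_iff {α : Type*} [SemilatticeSup α] {x : α} :
    (¬ IsMin x ∧ ¬ SupIrred x) ↔ ∃ a b, ¬ a ≤ b ∧ ¬ b ≤ a ∧ a ⊔ b = x := by
  constructor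
  · rintro ⟨hmin, hirr⟩
    simp only [SupIrred, not_and, not_forall, not_or] at hirr
    obtain ⟨a, b, rfl, ha, hb⟩ := hirr hmin
    exact ⟨a, b, fun h => hb (sup_eq_right.2 h).symm, fun h => ha (sup_eq_left.2 h).symm, rfl⟩
  · rintro ⟨a, b, hab, hba, rfl⟩
    refine ⟨fun h => hba (le_sup_right.trans (h le_sup_left)), fun h => ?_⟩
    rcases h.2 rfl with h | h
    · exact hba (sup_eq_left.1 h.symm)
    · exact hab (sup_eq_right.1 h.symm)

/-- The join in `L` of the images of two incomparable elements of `K` is join-reducible and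
determines their join in `K`. -/
theorem ncard_supReducible_le_of_orderEmbedding {K L : Type*} [SemilatticeSup K]
    [SemilatticeSup L] [Finite L] (f : K ↪o L) :
    Set.ncard {x : K | ¬ IsMin x ∧ ¬ SupIrred x} ≤
      Set.ncard {x : L | ¬ IsMin x ∧ ¬ SupIrred x} := by
  simp only [not_isMin_and_not_supIrred_iff]
  have key (x : K) (hx : ∃ a b, ¬ a ≤ b ∧ ¬ b ≤ a ∧ a ⊔ b = x) :
      ∃ y : L, (∃ a b, ¬ a ≤ b ∧ ¬ b ≤ a ∧ a ⊔ b = y) ∧ ∀ z, y ≤ f z ↔ x ≤ z := by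
    obtain ⟨a, b, hab, hba, rfl⟩ := hx
    exact ⟨f a ⊔ f b, ⟨f a, f b, by simpa using hab, by simpa using hba, rfl⟩, by simp⟩
  choose g hg hle using key
  refine Nat.card_le_card_of_injective (fun x => ⟨g x.1 x.2, hg x.1 x.2⟩) ?_
  rintro ⟨x, hx⟩ ⟨y, hy⟩ hxy
  have hxy : g x hx = g y hy := congrArg Subtype.val hxy
  refine Subtype.ext (le_antisymm ?_ ?_)
  · rw [← hle x hx, hxy, hle y hy]
  · rw [← hle y hy, ← hxy, hle x hx]

/-- If the finite lattice `K` is a subposet of the finite lattice `L`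
(witnessed by an order embedding `f : K ↪o L`), then `L` has at least as many
join-reducible elements as `K` (a join-reducible element is one that is neither the
bottom element, i.e. not minimal, nor join-irreducible), and dually for meet-reducible
elements. -/
theorem card_joinReducible_le_of_orderEmbedding
    {K L : Type*} [Lattice K] [Lattice L] [Fintype K] [Fintype L]
    (f : K ↪o L) :
    Set.ncard {x : K | ¬ IsMin x ∧ ¬ SupIrred x} ≤
        Set.ncard {x : L | ¬ IsMin x ∧ ¬ SupIrred x} ∧
      Set.ncard {x : K | ¬ IsMax x ∧ ¬ InfIrred x} ≤
        Set.ncard {x : L | ¬ IsMax x ∧ ¬ InfIrred x} :=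
  ⟨ncard_supReducible_le_of_orderEmbedding f, ncard_supReducible_le_of_orderEmbedding f.dual⟩
end

section
/- Let L be a finite lattice with n = |L| elements. If L has at least 4 join-reducible elements or at least 4 meet-reducible elements (that is, |Jred(L)| ≥ 4 or |Mred(L)| ≥ 4), then L has at most 2^(n−5) congruences, i.e. |Con(L)| ≤ 2^(n−5). -/
/-- A lattice congruence: an equivalence relation compatible with join and meet. -/
def IsLatCongr {L : Type*} [Lattice L] (θ : L → L → Prop) : Prop :=
  Equivalence θ ∧
    ∀ a b c d : L, θ a b → θ c d → θ (a ⊔ c) (b ⊔ d) ∧ θ (a ⊓ c) (b ⊓ d)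

namespace IsLatCongr

variable {L : Type*} [Lattice L] {θ φ : L → L → Prop}

lemma sup_left (h : IsLatCongr θ) {x z : L} (y : L) (hxz : θ x z) : θ (y ⊔ x) (y ⊔ z) :=
  (h.2 _ _ _ _ (h.1.refl y) hxz).1

lemma inf_left (h : IsLatCongr θ) {x z : L} (y : L) (hxz : θ x z) : θ (y ⊓ x) (y ⊓ z) :=
  (h.2 _ _ _ _ (h.1.refl y) hxz).2

lemma dual (h : IsLatCongr θ) : IsLatCongr (L := Lᵒᵈ) θ :=
  ⟨h.1, fun a b c d hab hcd => (h.2 a b c d hab hcd).symm⟩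

/-- If every join-irreducible element collapsed downwards by `θ` is also collapsed downwards
by `φ`, then `φ` contains all comparable pairs of `θ`. -/
lemma rel_of_le [Finite L] (hθ : IsLatCongr θ) (hφ : IsLatCongr φ)
    (h : ∀ p, SupIrred p → (∃ q < p, θ q p) → ∃ q < p, φ q p) (b : L) :
    ∀ a ≤ b, θ a b → φ a b := by
  induction b using WellFoundedLT.induction with
  | ind b ih =>
    intro a hab hθab
    rcases hab.eq_or_lt with rfl | hlt
    · exact hφ.1.refl a
    by_cases hb : SupIrred b
    · obtain ⟨r, hr, hφr⟩ := h b hb ⟨a, hlt, hθab⟩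
      have har : a ⊔ r < b :=
        lt_of_le_of_ne (sup_le hab hr.le) fun e => (hb.2 e).elim hlt.ne hr.ne
      have hφarb : φ (a ⊔ r) b := by
        simpa [sup_eq_right.2 hab] using hφ.sup_left a hφr
      have hθaar : θ a (a ⊔ r) := by
        simpa [inf_eq_left.2 har.le] using hθ.inf_left (a ⊔ r) hθab
      exact hφ.1.trans (ih _ har a le_sup_left hθaar) hφarb
    · obtain ⟨c, d, hcd, hc, hd⟩ : ∃ c d, c ⊔ d = b ∧ c < b ∧ d < b := by
        simpa [not_isMin_of_lt hlt] using not_supIrred.1 hb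
      have key : ∀ c < b, φ (c ⊓ a) c := fun c hc => ih c hc _ inf_le_left (by
        simpa [inf_eq_left.2 hc.le] using hθ.inf_left c hθab)
      have hφsup : φ ((c ⊓ a) ⊔ (d ⊓ a)) b :=
        hcd ▸ (hφ.2 _ _ _ _ (key c hc) (key d hd)).1
      simpa [sup_eq_right.2 hab] using hφ.sup_left a hφsup

lemma rel_of_rel [Finite L] (hθ : IsLatCongr θ) (hφ : IsLatCongr φ)
    (h : ∀ p, SupIrred p → (∃ q < p, θ q p) → ∃ q < p, φ q p) {a b : L} (hab : θ a b) :
    φ a b := by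
  have ha : θ (a ⊓ b) a := by simpa using hθ.inf_left a (hθ.1.symm hab)
  have hb : θ (a ⊓ b) b := by simpa [inf_comm] using hθ.inf_left b hab
  exact hφ.1.trans (hφ.1.symm (hθ.rel_of_le hφ h a _ inf_le_left ha))
    (hθ.rel_of_le hφ h b _ inf_le_right hb)

variable (L) in
/-- A congruence of a finite lattice is determined by the join-irreducible elements
it collapses. -/
lemma card_le_two_pow_ncard_supIrred [Finite L] :
    Nat.card {θ : L → L → Prop // IsLatCongr θ} ≤ 2 ^ {x : L | SupIrred x}.ncard := by
  let f : {θ : L → L → Prop // IsLatCongr θ} → Set {x : L | SupIrred x} :=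
    fun θ => {p | ∃ q < (p : L), θ.1 q p}
  have hf : Function.Injective f := by
    intro θ φ hθφ
    have key : ∀ p, SupIrred p → ((∃ q < p, θ.1 q p) ↔ ∃ q < p, φ.1 q p) := fun p hp =>
      Set.ext_iff.1 hθφ ⟨p, hp⟩
    ext a b
    exact ⟨θ.2.rel_of_rel φ.2 fun p hp => (key p hp).1,
      φ.2.rel_of_rel θ.2 fun p hp => (key p hp).2⟩
  calc _ ≤ Nat.card (Set {x : L | SupIrred x}) := Nat.card_le_card_of_injective f hf
    _ = _ := by
      have := Fintype.ofFinite {x : L | SupIrred x}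
      rw [Nat.card_eq_fintype_card, Fintype.card_set, ← Nat.card_eq_fintype_card,
        Nat.card_coe_set_eq]

end IsLatCongr

lemma ncard_supIrred_add_ncard_supReducible_lt (L : Type*) [Lattice L] [Finite L] [Nonempty L] :
    {x : L | SupIrred x}.ncard + {x : L | ¬ IsMin x ∧ ¬ SupIrred x}.ncard < Nat.card L := by
  obtain ⟨m, hm⟩ := Set.finite_univ.exists_minimal (Set.univ_nonempty (α := L))
  have hm' : IsMin m := minimal_true.1 (by simpa using hm)
  rw [← Set.ncard_union_eq (Set.disjoint_left.2 fun x hx hx' => hx'.2 hx), ← Set.ncard_univ]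
  refine Set.ncard_lt_ncard (Set.ssubset_univ_iff.2 fun e => ?_)
  rcases e.symm.subset (Set.mem_univ m) with h | h
  exacts [h.1 hm', h.1 hm']

lemma card_congr_le_of_four_supReducible {L : Type*} [Lattice L] [Finite L]
    (h : 4 ≤ {x : L | ¬ IsMin x ∧ ¬ SupIrred x}.ncard) :
    Nat.card {θ : L → L → Prop // IsLatCongr θ} ≤ 2 ^ (Nat.card L - 5) := by
  obtain ⟨x, -⟩ := Set.nonempty_of_ncard_ne_zero (Nat.ne_of_gt (lt_of_lt_of_le four_pos h))
  have : Nonempty L := ⟨x⟩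
  have hlt := ncard_supIrred_add_ncard_supReducible_lt L
  exact (IsLatCongr.card_le_two_pow_ncard_supIrred L).trans
    (Nat.pow_le_pow_right two_pos (by lia))

/-- If a finite lattice `L` with `n` elements has at least 4 join-reducible
elements or at least 4 meet-reducible elements, then `L` has at most `2 ^ (n - 5)`
congruences. -/
theorem card_congr_le_of_four_reducible
    {L : Type*} [Lattice L] [Fintype L]
    (h : 4 ≤ Set.ncard {x : L | ¬ IsMin x ∧ ¬ SupIrred x} ∨
         4 ≤ Set.ncard {x : L | ¬ IsMax x ∧ ¬ InfIrred x}) :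
    Nat.card {θ : L → L → Prop // IsLatCongr θ} ≤ 2 ^ (Fintype.card L - 5) := by
  rw [← Nat.card_eq_fintype_card]
  rcases h with h | h
  · exact card_congr_le_of_four_supReducible h
  · have hdual := card_congr_le_of_four_supReducible (L := Lᵒᵈ) h
    refine le_trans (Nat.card_congr (Equiv.subtypeEquivRight fun θ => ?_)).le hdual
    exact ⟨fun hθ => hθ.dual, fun hθ => hθ.dual⟩
end

section
/- Let L be a finite lattice with n = |L| elements. If L has exactly 3 join-reducible elements (|Jred(L)| = 3) and there exist two distinct nonzero join-irreducible elements p, q ∈ Jir(L) such that con(p_*, p) = con(q_*, q), where p_* and q_* denote the unique lower covers of p and q, then |Con(L)| ≤ 2^(n−5). -/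
/-- `latConGen a b` is the smallest congruence collapsing `a` and `b`, described as the
intersection of all congruences containing the pair `(a, b)`. -/
def latConGen {L : Type*} [Lattice L] (a b : L) : L → L → Prop :=
  fun x y => ∀ θ : L → L → Prop, IsLatCongr θ → θ a b → θ x y

namespace IsLatCongr

variable {L : Type*} [Lattice L] {θ : L → L → Prop}

lemma refl (h : IsLatCongr θ) (a : L) : θ a a := h.1.refl a

lemma sup_right (h : IsLatCongr θ) {a b : L} (hab : θ a b) (c : L) : θ (a ⊔ c) (b ⊔ c) :=
  (h.2 a b c c hab (h.refl c)).1

lemma inf_right (h : IsLatCongr θ) {a b : L} (hab : θ a b) (c : L) : θ (a ⊓ c) (b ⊓ c) :=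
  (h.2 a b c c hab (h.refl c)).2

lemma inf_sup_iff (h : IsLatCongr θ) {a b : L} : θ (a ⊓ b) (a ⊔ b) ↔ θ a b :=
  LatticeCon.r_inf_sup_iff
    { r := θ, iseqv := h.1, inf := fun h₁ h₂ => (h.2 _ _ _ _ h₁ h₂).2,
      sup := fun h₁ h₂ => (h.2 _ _ _ _ h₁ h₂).1 }

end IsLatCongr

section

variable {L : Type*} [Lattice L]

lemma SupIrred.le_of_lt_of_covBy {a b z : L} (hz : SupIrred z) (ha : a < z) (hb : b ⋖ z) :
    a ≤ b := by
  by_contra hab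
  have hlt : b < a ⊔ b := right_lt_sup.2 hab
  rcases hz.2 ((sup_le ha.le hb.le).eq_of_not_lt (hb.2 hlt)) with h | h
  · exact ha.ne h
  · exact hb.ne h

lemma SupIrred.covBy_unique {a b z : L} (hz : SupIrred z) (ha : a ⋖ z) (hb : b ⋖ z) : a = b :=
  (hz.le_of_lt_of_covBy ha.lt hb).antisymm (hz.le_of_lt_of_covBy hb.lt ha)

/-- The join-irreducible elements that a relation identifies with a lower cover. -/
def collapsedSupIrred (θ : L → L → Prop) : Set L :=
  {z | SupIrred z ∧ ∃ w, w ⋖ z ∧ θ w z}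

lemma SupIrred.mem_collapsedSupIrred_iff {θ : L → L → Prop} {w z : L} (hz : SupIrred z)
    (hw : w ⋖ z) : z ∈ collapsedSupIrred θ ↔ θ w z := by
  refine ⟨fun ⟨_, v, hv, h⟩ => ?_, fun h => ⟨hz, w, hw, h⟩⟩
  rwa [hz.covBy_unique hw hv]

lemma latConGen_self (a b : L) : latConGen a b a b := fun _ _ h => h

lemma mem_collapsedSupIrred_iff_of_latConGen_eq {θ : L → L → Prop} (hθ : IsLatCongr θ)
    {p q p' q' : L} (hp : SupIrred p) (hq : SupIrred q) (hp' : p' ⋖ p) (hq' : q' ⋖ q)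
    (hcon : latConGen p' p = latConGen q' q) :
    p ∈ collapsedSupIrred θ ↔ q ∈ collapsedSupIrred θ := by
  rw [hp.mem_collapsedSupIrred_iff hp', hq.mem_collapsedSupIrred_iff hq']
  have hpq : latConGen p' p q' q := hcon ▸ latConGen_self q' q
  have hqp : latConGen q' q p' p := hcon ▸ latConGen_self p' p
  exact ⟨hpq θ hθ, hqp θ hθ⟩

variable [Finite L]

lemma IsLatCongr.sup_of_collapsedSupIrred_subset {θ φ : L → L → Prop} (hθ : IsLatCongr θ)
    (hφ : IsLatCongr φ) (h : collapsedSupIrred θ ⊆ collapsedSupIrred φ) {x y : L}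
    (hxy : θ x y) (z : L) (hz : z ≤ y) : φ x (x ⊔ z) := by
  induction z using WellFoundedLT.induction with
  | ind z ih =>
    by_cases hzx : z ≤ x
    · rw [sup_eq_left.2 hzx]
      exact hφ.refl x
    by_cases hirr : SupIrred z
    · have hlt : x ⊓ z < z := inf_lt_right.2 hzx
      obtain ⟨w, hw, hwz⟩ := exists_le_covBy_of_lt hlt
      have hθz : θ (x ⊓ z) z := by simpa [inf_eq_right.2 hz] using hθ.inf_right hxy z
      have hθw : θ w z := by
        simpa [sup_eq_right.2 hw, sup_eq_left.2 hwz.le] using hθ.sup_right hθz w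
      have hφw := (hirr.mem_collapsedSupIrred_iff hwz).1 (h ⟨hirr, w, hwz, hθw⟩)
      have hsup := hφ.sup_right hφw x
      rw [sup_comm w, sup_comm z] at hsup
      exact hφ.1.trans (ih w hwz.lt (hwz.le.trans hz)) hsup
    · rcases not_supIrred.1 hirr with hmin | ⟨a, b, rfl, ha, hb⟩
      · exact absurd ((hmin inf_le_right).trans inf_le_left) hzx
      · have := (hφ.2 _ _ _ _ (ih a ha (ha.le.trans hz)) (ih b hb (hb.le.trans hz))).1
        rwa [sup_idem, ← sup_sup_distrib_left] at this

lemma IsLatCongr.le_of_collapsedSupIrred_subset {θ φ : L → L → Prop} (hθ : IsLatCongr θ)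
    (hφ : IsLatCongr φ) (h : collapsedSupIrred θ ⊆ collapsedSupIrred φ) : θ ≤ φ := by
  intro x y hxy
  have := hθ.sup_of_collapsedSupIrred_subset hφ h (hθ.inf_sup_iff.2 hxy) (x ⊔ y) le_rfl
  rw [sup_eq_right.2 inf_le_sup] at this
  exact hφ.inf_sup_iff.1 this

/-- A congruence of a finite lattice is determined by the join-irreducibles it collapses. -/
lemma IsLatCongr.eq_of_collapsedSupIrred_eq {θ φ : L → L → Prop} (hθ : IsLatCongr θ)
    (hφ : IsLatCongr φ) (h : collapsedSupIrred θ = collapsedSupIrred φ) : θ = φ :=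
  (hθ.le_of_collapsedSupIrred_subset hφ h.le).antisymm
    (hφ.le_of_collapsedSupIrred_subset hθ h.ge)

lemma ncard_supIrred_add_ncard_joinReducible_add_one [Nonempty L] :
    {x : L | SupIrred x}.ncard + {x : L | ¬ IsMin x ∧ ¬ SupIrred x}.ncard + 1 = Nat.card L := by
  obtain ⟨m, hm⟩ := (Set.toFinite (Set.univ : Set L)).exists_minimal Set.univ_nonempty
  have hmin : IsMin m := fun b hb => hm.2 trivial hb
  have hU : {x : L | SupIrred x}ᶜ = insert m {x : L | ¬ IsMin x ∧ ¬ SupIrred x} := by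
    ext x
    simp only [Set.mem_compl_iff, Set.mem_ofPred_eq, Set.mem_insert_iff]
    constructor
    · intro hx
      by_cases hxm : IsMin x
      · exact Or.inl ((hxm inf_le_left |>.trans inf_le_right).antisymm
          (hmin inf_le_right |>.trans inf_le_left))
      · exact Or.inr ⟨hxm, hx⟩
    · rintro (rfl | hx)
      · exact fun h => h.1 hmin
      · exact hx.2
  have hcard := Set.ncard_add_ncard_compl {x : L | SupIrred x}
  rwa [hU, Set.ncard_insert_of_notMem (fun h => h.1 hmin), ← add_assoc] at hcard

/-- If two distinct join-irreducibles generate the same congruence, then the congruences embed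
into the subsets of the remaining join-irreducibles. -/
lemma card_congr_le_two_pow_ncard_supIrred_sub_one {p q p' q' : L} (hp : SupIrred p)
    (hq : SupIrred q) (hpq : p ≠ q) (hp' : p' ⋖ p) (hq' : q' ⋖ q)
    (hcon : latConGen p' p = latConGen q' q) :
    Nat.card {θ : L → L → Prop // IsLatCongr θ} ≤ 2 ^ ({x : L | SupIrred x}.ncard - 1) := by
  let J : Set L := {x | SupIrred x} \ {q}
  let f : {θ : L → L → Prop // IsLatCongr θ} → 𝒫 J :=
    fun θ => ⟨collapsedSupIrred θ.1 \ {q}, Set.sdiff_subset_sdiff_left fun _ hz => hz.1⟩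
  have hf : Function.Injective f := by
    intro θ φ h
    have hdiff (z : L) (hzq : z ≠ q) :
        z ∈ collapsedSupIrred θ.1 ↔ z ∈ collapsedSupIrred φ.1 := by
      simpa [f, hzq] using Set.ext_iff.1 (congrArg Subtype.val h) z
    refine Subtype.ext (θ.2.eq_of_collapsedSupIrred_eq φ.2 (Set.ext fun z => ?_))
    by_cases hzq : z = q
    · rw [hzq, ← mem_collapsedSupIrred_iff_of_latConGen_eq θ.2 hp hq hp' hq' hcon,
        ← mem_collapsedSupIrred_iff_of_latConGen_eq φ.2 hp hq hp' hq' hcon]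
      exact hdiff p hpq
    · exact hdiff z hzq
  have hJ : J.ncard = {x : L | SupIrred x}.ncard - 1 := Set.ncard_sdiff_singleton_of_mem hq
  rw [← hJ, ← Set.ncard_powerset J]
  exact Nat.card_le_card_of_injective f hf

end

/-- If a finite lattice `L` with `n` elements has exactly 3 join-reducible
elements and there are two distinct join-irreducible elements `p ≠ q`, with lower covers
`p'` and `q'` respectively, such that `con(p', p) = con(q', q)`, then `L` has at most
`2 ^ (n - 5)` congruences. -/
theorem card_congr_le_of_three_joinReducible
    {L : Type*} [Lattice L] [Fintype L]
    (h3 : Set.ncard {x : L | ¬ IsMin x ∧ ¬ SupIrred x} = 3)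
    (p q p' q' : L) (hp : SupIrred p) (hq : SupIrred q) (hpq : p ≠ q)
    (hp' : p' ⋖ p) (hq' : q' ⋖ q)
    (hcon : latConGen p' p = latConGen q' q) :
    Nat.card {θ : L → L → Prop // IsLatCongr θ} ≤ 2 ^ (Fintype.card L - 5) := by
  have : Nonempty L := ⟨p⟩
  have hcard := ncard_supIrred_add_ncard_joinReducible_add_one (L := L)
  rw [h3, Nat.card_eq_fintype_card] at hcard
  rw [show Fintype.card L - 5 = {x : L | SupIrred x}.ncard - 1 by omega]
  exact card_congr_le_two_pow_ncard_supIrred_sub_one hp hq hpq hp' hq' hcon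
end

section
/- For every natural number n ≥ 8 there exists a finite lattice L with exactly n elements such that L has exactly 2^(n−5) congruences, i.e. |Con(L)| = 2^(n−5), and L is not dismantlable. -/
/-- A finite lattice `L` with `n` elements is dismantlable if there is a chain
`L₁ ⊂ L₂ ⊂ ⋯ ⊂ Lₙ = L` of sublattices (subsets closed under the join and meet of `L`)
with `|Lᵢ| = i` for every `i`. -/
def Dismantlable (L : Type*) [Lattice L] [Fintype L] : Prop :=
  ∃ S : Fin (Fintype.card L) → Set L,
    (∀ i, ∀ a ∈ S i, ∀ b ∈ S i, a ⊔ b ∈ S i ∧ a ⊓ b ∈ S i) ∧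
    (∀ i j, i < j → S i ⊂ S j) ∧
    (∀ i : Fin (Fintype.card L), (S i).ncard = (i : ℕ) + 1) ∧
    (∀ i : Fin (Fintype.card L), (i : ℕ) = Fintype.card L - 1 → S i = Set.univ)

/-- A lattice is not dismantlable if it has a nonempty subset each of whose elements is the join
or the meet of two other elements of that subset. -/
theorem not_dismantlable_of_subset {L : Type*} [Lattice L] [Fintype L] (B : Set L)
    (hne : B.Nonempty)
    (hB : ∀ b ∈ B, ∃ x ∈ B, ∃ y ∈ B, x ≠ b ∧ y ≠ b ∧ (x ⊔ y = b ∨ x ⊓ y = b)) :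
    ¬ Dismantlable L := by
  rintro ⟨S, hclosed, hmono, hcard, htop⟩
  have key : ∀ (m : ℕ) (hm : m < Fintype.card L), ¬ B ⊆ S ⟨m, hm⟩ := by
    intro m
    induction m with
    | zero =>
      intro hm hsub
      obtain ⟨b, hb⟩ := hne
      obtain ⟨x, hx, -, -, hxb, -⟩ := hB b hb
      obtain ⟨c, hc⟩ := Set.ncard_eq_one.mp (hcard ⟨0, hm⟩)
      have h₁ := hsub hx
      have h₂ := hsub hb
      rw [hc, Set.mem_singleton_iff] at h₁ h₂
      exact hxb (h₁.trans h₂.symm)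
    | succ m ih =>
      intro hm hsub
      have hm' : m < Fintype.card L := by omega
      obtain ⟨b, hb, hbS⟩ := Set.not_subset.mp (ih hm')
      have hins : insert b (S ⟨m, hm'⟩) = S ⟨m + 1, hm⟩ := by
        apply Set.eq_of_subset_of_ncard_le _ _ (Set.toFinite _)
        · exact Set.insert_subset (hsub hb)
            (hmono ⟨m, hm'⟩ ⟨m + 1, hm⟩ (Fin.mk_lt_mk.mpr m.lt_succ_self)).subset
        · rw [Set.ncard_insert_of_notMem hbS, hcard, hcard]
      have hmem : ∀ x ∈ B, x ≠ b → x ∈ S ⟨m, hm'⟩ := fun x hx hxb =>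
        Set.mem_of_mem_insert_of_ne (hins ▸ hsub hx) hxb
      obtain ⟨x, hx, y, hy, hxb, hyb, h⟩ := hB b hb
      have hxy := hclosed _ x (hmem x hx hxb) y (hmem y hy hyb)
      rcases h with h | h
      · exact hbS (h ▸ hxy.1)
      · exact hbS (h ▸ hxy.2)
  have hpos : 0 < Fintype.card L := Fintype.card_pos_iff.mpr ⟨hne.some⟩
  refine key (Fintype.card L - 1) (by omega) ?_
  rw [htop _ rfl]
  exact Set.subset_univ B

/-- The congruence `x ⊔ a = y ⊔ a` of a distributive lattice. -/
theorem isLatCongr_sup_eq {L : Type*} [DistribLattice L] (a : L) :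
    IsLatCongr (fun x y : L => x ⊔ a = y ⊔ a) := by
  refine ⟨⟨fun _ => rfl, Eq.symm, Eq.trans⟩, fun x y z w h₁ h₂ => ?_⟩
  beta_reduce at h₁ h₂ ⊢
  constructor
  · rw [sup_sup_distrib_right x z, h₁, h₂, ← sup_sup_distrib_right]
  · rw [sup_inf_right, h₁, h₂, ← sup_inf_right]

/-- A finite Boolean algebra has as many congruences as elements. -/
theorem card_congr_of_booleanAlgebra (L : Type*) [BooleanAlgebra L] [Finite L] :
    Nat.card {θ : L → L → Prop // IsLatCongr θ} = Nat.card L := by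
  refine (Nat.card_congr (Equiv.ofBijective (fun a : L =>
    (⟨_, isLatCongr_sup_eq a⟩ : {θ : L → L → Prop // IsLatCongr θ})) ⟨?_, ?_⟩)).symm
  · intro a b hab
    have h : ∀ x y : L, x ⊔ a = y ⊔ a ↔ x ⊔ b = y ⊔ b := fun x y =>
      iff_of_eq (congrFun (congrFun (congrArg Subtype.val hab) x) y)
    apply le_antisymm
    · simpa using (h a ⊥).mp (by simp)
    · simpa using (h b ⊥).mpr (by simp)
  · rintro ⟨θ, ⟨hrefl, hsymm, htrans⟩, hθ⟩
    have hfin : {x | θ x ⊥}.Finite := Set.toFinite _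
    set a := hfin.toFinset.sup id
    have haθ : θ a ⊥ := by
      refine Finset.sup_induction (p := fun x => θ x ⊥) (hrefl ⊥) ?_ ?_
      · intro x hx y hy
        simpa using (hθ x ⊥ y ⊥ hx hy).1
      · intro x hx
        simpa using hx
    have hle : ∀ x y, θ x y → x ≤ y ⊔ a := by
      intro x y hxy
      have h₁ : θ (x ⊓ yᶜ) ⊥ := by simpa using (hθ x y yᶜ yᶜ hxy (hrefl _)).2
      have h₂ : x ⊓ yᶜ ≤ a := Finset.le_sup (f := id) (hfin.mem_toFinset.mpr h₁)
      rwa [← sdiff_eq, sdiff_le_iff] at h₂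
    have hsup : ∀ x, θ (x ⊔ a) x := fun x => by
      simpa using (hθ x x a ⊥ (hrefl x) haθ).1
    refine ⟨a, Subtype.ext (funext fun x => funext fun y => propext ⟨fun h => ?_, fun h => ?_⟩)⟩
    · have h : x ⊔ a = y ⊔ a := h
      exact htrans (hsymm (hsup x)) (h ▸ hsup y)
    · exact le_antisymm (sup_le (hle x y h) le_sup_right)
        (sup_le (hle y x (hsymm h)) le_sup_right)

/-- The congruence of `WithTop L` extending `θ` that identifies the old top `⊤` of `L` with the
new one if and only if `p` holds. -/
theorem isLatCongr_withTop {L : Type*} [Lattice L] [OrderTop L] {θ : L → L → Prop}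
    (hθ : IsLatCongr θ) (p : Prop) :
    IsLatCongr (fun x y : WithTop L =>
      θ (x.untopD ⊤) (y.untopD ⊤) ∧ (p ∨ (x = ⊤ ↔ y = ⊤))) := by
  obtain ⟨⟨hrefl, hsymm, htrans⟩, hθ⟩ := hθ
  have hsup : ∀ x y : WithTop L, (x ⊔ y).untopD ⊤ = x.untopD ⊤ ⊔ y.untopD ⊤ := by
    intro x y
    induction x <;> induction y <;> simp [← WithTop.coe_sup]
  have hinf : ∀ x y : WithTop L, (x ⊓ y).untopD ⊤ = x.untopD ⊤ ⊓ y.untopD ⊤ := by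
    intro x y
    induction x <;> induction y <;> simp [← WithTop.coe_inf]
  have hsup_top : ∀ x y : WithTop L, x ⊔ y = ⊤ ↔ x = ⊤ ∨ y = ⊤ := by
    intro x y
    induction x <;> induction y <;> simp [← WithTop.coe_sup]
  refine ⟨⟨fun x => ⟨hrefl _, Or.inr Iff.rfl⟩, fun h => ⟨hsymm h.1, h.2.imp id Iff.symm⟩,
    fun h₁ h₂ => ⟨htrans h₁.1 h₂.1, by tauto⟩⟩, fun x y z w h₁ h₂ => ⟨⟨?_, ?_⟩, ⟨?_, ?_⟩⟩⟩
  · rw [hsup, hsup]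
    exact (hθ _ _ _ _ h₁.1 h₂.1).1
  · rw [hsup_top, hsup_top]
    tauto
  · rw [hinf, hinf]
    exact (hθ _ _ _ _ h₁.1 h₂.1).2
  · rw [inf_eq_top_iff, inf_eq_top_iff]
    tauto

/-- Adding a new top element to a lattice with a top doubles the number of congruences. -/
theorem card_congr_withTop (L : Type*) [Lattice L] [OrderTop L] :
    Nat.card {θ : WithTop L → WithTop L → Prop // IsLatCongr θ} =
      Nat.card {θ : L → L → Prop // IsLatCongr θ} * 2 := by
  have e : {θ : WithTop L → WithTop L → Prop // IsLatCongr θ} ≃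
      {θ : L → L → Prop // IsLatCongr θ} × Prop :=
    { toFun := fun θ => (⟨fun x y => θ.1 x y, ⟨fun x => θ.2.1.refl x, fun h => θ.2.1.symm h,
          fun h₁ h₂ => θ.2.1.trans h₁ h₂⟩, fun a b c d h₁ h₂ => θ.2.2 a b c d h₁ h₂⟩,
        θ.1 ((⊤ : L) : WithTop L) ⊤)
      invFun := fun q => ⟨_, isLatCongr_withTop q.1.2 q.2⟩
      left_inv := by
        rintro ⟨θ, ⟨hrefl, hsymm, htrans⟩, hθ⟩
        have hcoe : ∀ x : L, θ x ⊤ ↔ θ x (⊤ : L) ∧ θ (⊤ : L) ⊤ := by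
          intro x
          refine ⟨fun h => ?_, fun h => htrans h.1 h.2⟩
          have ht : θ (⊤ : L) ⊤ := by
            simpa [← WithTop.coe_sup] using (hθ _ _ _ _ h (hrefl ((⊤ : L) : WithTop L))).1
          exact ⟨htrans h (hsymm ht), ht⟩
        have hcomm : ∀ x y, θ x y ↔ θ y x := fun x y => ⟨fun h => hsymm h, fun h => hsymm h⟩
        refine Subtype.ext (funext fun x => funext fun y => propext ?_)
        induction x <;> induction y
        · simp [hrefl]
        · rename_i y
          simp [hcomm ⊤ (y : WithTop L), hcoe y, hcomm ((⊤ : L) : WithTop L) (y : WithTop L)]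
        · rename_i x
          simp [hcoe x]
        · simp
      right_inv := by
        rintro ⟨⟨θ, hθ⟩, p⟩
        simp [hθ.1.refl] }
  rw [Nat.card_congr e, Nat.card_prod]
  simp

/-- For every `n ≥ 8` the ordinal sum of the `8`-element Boolean lattice and a chain with `n - 8`
elements has the required properties; the chain is added one element at a time. -/
theorem exists_lattice_with_pow_congr (n : ℕ) (hn : 8 ≤ n) :
    ∃ (L : Type) (_ : Lattice L) (_ : Fintype L) (_ : OrderTop L) (B : Set L),
      Fintype.card L = n ∧
      Nat.card {θ : L → L → Prop // IsLatCongr θ} = 2 ^ (n - 5) ∧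
      B.Nonempty ∧
      ∀ b ∈ B, ∃ x ∈ B, ∃ y ∈ B, x ≠ b ∧ y ≠ b ∧ (x ⊔ y = b ∨ x ⊓ y = b) := by
  induction n, hn using Nat.le_induction with
  | base =>
    refine ⟨Finset (Fin 3), inferInstance, inferInstance, inferInstance, Set.univ, by simp, ?_,
      Set.univ_nonempty, ?_⟩
    · rw [card_congr_of_booleanAlgebra]
      simp
    · simp only [Set.mem_univ, true_and, forall_const]
      decide
  | succ n hn ih =>
    obtain ⟨L, _, _, _, B, hcard, hcon, hne, hB⟩ := ih
    refine ⟨WithTop L, inferInstance, inferInstanceAs (Fintype (Option L)), inferInstance,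
      (↑) '' B, (Fintype.card_option (α := L)).trans (by rw [hcard]), ?_, hne.image _, ?_⟩
    · rw [card_congr_withTop, hcon, ← pow_succ]
      congr 1
      omega
    · rintro _ ⟨b, hb, rfl⟩
      obtain ⟨x, hx, y, hy, hxb, hyb, h⟩ := hB b hb
      refine ⟨x, ⟨x, hx, rfl⟩, y, ⟨y, hy, rfl⟩, by simpa using hxb, by simpa using hyb, ?_⟩
      rcases h with rfl | rfl
      · exact Or.inl rfl
      · exact Or.inr rfl

/-- For every `n ≥ 8` there is an `n`-element finite lattice with exactly
`2 ^ (n - 5)` congruences that is not dismantlable. -/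
theorem exists_nonDismantlable_with_pow_congr (n : ℕ) (hn : 8 ≤ n) :
    ∃ (L : Type) (iL : Lattice L) (iF : Fintype L),
      @Fintype.card L iF = n ∧
      Nat.card {θ : L → L → Prop // @IsLatCongr L iL θ} = 2 ^ (n - 5) ∧
      ¬ @Dismantlable L iL iF := by
  obtain ⟨L, iL, iF, _, B, hcard, hcon, hne, hB⟩ := exists_lattice_with_pow_congr n hn
  exact ⟨L, iL, iF, hcard, hcon, not_dismantlable_of_subset B hne hB⟩
end

section
/- Let L be a finite nonempty distributive lattice. Then the number of congruences of L equals 2 raised to the number of (nonzero) join-irreducible elements of L, i.e. |Con(L)| = 2^|Jir(L)|. -/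
/-- The relation identifying two elements that lie above the same elements of `S`. -/
def sameBelow {L : Type*} [Lattice L] (S : Set {p : L // SupIrred p}) (a b : L) : Prop :=
  ∀ p ∈ S, p.1 ≤ a ↔ p.1 ≤ b

/-- The join-irreducible elements not collapsed to anything strictly below them. -/
def uncollapsed {L : Type*} [Lattice L] (θ : L → L → Prop) : Set {p : L // SupIrred p} :=
  {p | ∀ q < p.1, ¬ θ q p.1}

theorem isLatCongr_sameBelow {L : Type*} [DistribLattice L] (S : Set {p : L // SupIrred p}) :
    IsLatCongr (sameBelow S) := by
  refine ⟨⟨fun a p _ => Iff.rfl, fun h p hp => (h p hp).symm,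
    fun h h' p hp => (h p hp).trans (h' p hp)⟩,
    fun a b c d hab hcd => ⟨fun p hp => ?_, fun p hp => ?_⟩⟩
  · have hprime : SupPrime p.1 := supPrime_iff_supIrred.2 p.2
    rw [hprime.le_sup, hprime.le_sup, hab p hp, hcd p hp]
  · rw [le_inf_iff, le_inf_iff, hab p hp, hcd p hp]

theorem uncollapsed_sameBelow {L : Type*} [Lattice L] [Finite L]
    (S : Set {p : L // SupIrred p}) : uncollapsed (sameBelow S) = S := by
  ext p
  refine ⟨fun hp => ?_, fun hp q hq h => hq.not_ge ((h p hp).2 le_rfl)⟩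
  by_contra hpS
  obtain ⟨b, hb⟩ := not_isMin_iff.1 p.2.not_isMin
  obtain ⟨q, -, hq⟩ := exists_le_covBy_of_lt hb
  refine hp q hq.lt fun r hr => ⟨fun h => h.trans hq.le, fun h => ?_⟩
  have hrp : r.1 < p.1 := h.lt_of_ne fun e => hpS (Subtype.ext e ▸ hr)
  have hne : r.1 ⊔ q ≠ p.1 := fun e => (p.2.2 e).elim hrp.ne hq.lt.ne
  by_contra hrq
  exact hq.2 (right_lt_sup.2 hrq) ((sup_le h hq.le).lt_of_ne hne)

theorem IsLatCongr.sameBelow_uncollapsed_of_rel {L : Type*} [Lattice L] {θ : L → L → Prop}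
    (hθ : IsLatCongr θ) {a b : L} (h : θ a b) :
    sameBelow (uncollapsed θ) a b := by
  have key : ∀ {a b : L}, θ a b → ∀ p ∈ uncollapsed θ, p.1 ≤ a → p.1 ≤ b := by
    intro a b h p hp hpa
    by_contra hpb
    have hinf := (hθ.2 _ _ _ _ (hθ.1.refl p.1) h).2
    rw [inf_eq_left.2 hpa] at hinf
    exact hp _ (inf_lt_left.2 hpb) (hθ.1.symm hinf)
  exact fun p hp => ⟨key h p hp, key (hθ.1.symm h) p hp⟩

theorem IsLatCongr.rel_inf_of_forall_uncollapsed {L : Type*} [DistribLattice L] [Finite L]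
    {θ : L → L → Prop} (hθ : IsLatCongr θ) {a b : L}
    (h : ∀ p ∈ uncollapsed θ, p.1 ≤ a → p.1 ≤ b) : θ (a ⊓ b) a := by
  suffices ∀ x ≤ a, θ (x ⊓ b) x from this a le_rfl
  intro x
  induction x using WellFoundedLT.induction with
  | ind x ih =>
    intro hxa
    by_cases hx : SupIrred x
    · by_cases hxS : (⟨x, hx⟩ : {p : L // SupIrred p}) ∈ uncollapsed θ
      · rw [inf_eq_left.2 (h _ hxS hxa)]
        exact hθ.1.refl x
      · obtain ⟨q, hq, hqx⟩ : ∃ q < x, θ q x := by simpa [uncollapsed] using hxS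
        have hinf := (hθ.2 _ _ _ _ hqx (hθ.1.refl b)).2
        exact hθ.1.trans (hθ.1.symm hinf) (hθ.1.trans (ih q hq (hq.le.trans hxa)) hqx)
    · rcases not_supIrred.1 hx with hmin | ⟨y, z, rfl, hy, hz⟩
      · rw [hmin.eq_of_le inf_le_left]
        exact hθ.1.refl x
      · rw [inf_sup_right]
        exact (hθ.2 _ _ _ _ (ih y hy (hy.le.trans hxa)) (ih z hz (hz.le.trans hxa))).1

theorem IsLatCongr.sameBelow_uncollapsed {L : Type*} [DistribLattice L] [Finite L]
    {θ : L → L → Prop} (hθ : IsLatCongr θ) : sameBelow (uncollapsed θ) = θ := by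
  ext a b
  refine ⟨fun h => ?_, hθ.sameBelow_uncollapsed_of_rel⟩
  have ha := hθ.rel_inf_of_forall_uncollapsed fun p hp => (h p hp).1
  have hb := hθ.rel_inf_of_forall_uncollapsed fun p hp => (h p hp).2
  rw [inf_comm] at hb
  exact hθ.1.trans (hθ.1.symm ha) hb

/-- Congruences of a finite distributive lattice correspond to sets of join-irreducibles. -/
def latCongrEquiv (L : Type*) [DistribLattice L] [Finite L] :
    {θ : L → L → Prop // IsLatCongr θ} ≃ Set {p : L // SupIrred p} where
  toFun θ := uncollapsed θ.1
  invFun S := ⟨sameBelow S, isLatCongr_sameBelow S⟩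
  left_inv θ := Subtype.ext θ.2.sameBelow_uncollapsed
  right_inv := uncollapsed_sameBelow

/-- A finite nonempty distributive lattice `L` has exactly
`2 ^ |Jir(L)|` congruences, where `Jir(L)` is the set of (nonzero) join-irreducible
elements of `L`. -/
theorem card_congr_of_distrib
    {L : Type*} [DistribLattice L] [Fintype L] [Nonempty L] :
    Nat.card {θ : L → L → Prop // IsLatCongr θ} =
      2 ^ Set.ncard {x : L | SupIrred x} := by
  classical
  rw [Nat.card_congr (latCongrEquiv L), Nat.card_eq_fintype_card, Fintype.card_set,
    ← Nat.card_eq_fintype_card]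
  rfl
end

section
/- Let L be a finite nonempty lattice. Define an equivalence relation ≈ on the set Jir(L) of nonzero join-irreducible elements of L by p ≈ q if and only if con(p_*, p) = con(q_*, q), where p_* denotes the unique lower cover of p. Then the number of congruences of L is at most 2 raised to the number of ≈-equivalence classes, i.e. |Con(L)| ≤ 2^|Jir(L)/≈|. -/
/-- If every prime quotient `p' ⋖ p` with `p` join-irreducible collapsed by `θ` is collapsed by `ψ`,
and `θ` relates `a` and `b`, then `ψ` relates `x ⊓ a` and `x` for every `x ≤ b`. -/
theorem IsLatCongr.inf_rel_of_le {L : Type*} [Lattice L] [Finite L] {θ ψ : L → L → Prop}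
    (hθ : IsLatCongr θ) (hψ : IsLatCongr ψ)
    (h : ∀ p p' : L, SupIrred p → p' ⋖ p → θ p' p → ψ p' p)
    {a b : L} (hab : θ a b) (x : L) (hx : x ≤ b) : ψ (x ⊓ a) x := by
  induction x using WellFoundedLT.induction with
  | _ x ih =>
    by_cases hxa : x ≤ a
    · rw [inf_eq_left.mpr hxa]
      exact hψ.1.refl x
    by_cases hirr : SupIrred x
    · have hlt : x ⊓ a < x := inf_lt_left.mpr hxa
      obtain ⟨x', hle, hcov⟩ := exists_le_covBy_of_lt hlt
      have hθx : θ (x ⊓ a) x := by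
        simpa [inf_eq_left.mpr hx] using (hθ.2 _ _ _ _ (hθ.1.refl x) hab).2
      have hθc : θ x' x := by
        simpa [sup_eq_right.mpr hle, sup_eq_left.mpr hcov.le] using
          (hθ.2 _ _ _ _ hθx (hθ.1.refl x')).1
      have heq : x' ⊓ a = x ⊓ a :=
        le_antisymm (inf_le_inf_right a hcov.le) (le_inf hle inf_le_right)
      exact heq ▸ hψ.1.trans (ih x' hcov.lt (hcov.le.trans hx)) (h x x' hirr hcov hθc)
    · rcases not_supIrred.mp hirr with hmin | ⟨y, z, rfl, hy, hz⟩
      · exact absurd ((hmin inf_le_left).trans inf_le_right) hxa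
      · have hyz := (hψ.2 _ _ _ _ (ih y hy (hy.le.trans hx)) (ih z hz (hz.le.trans hx))).1
        have hle : y ⊓ a ⊔ z ⊓ a ≤ (y ⊔ z) ⊓ a :=
          sup_le (inf_le_inf_right a le_sup_left) (inf_le_inf_right a le_sup_right)
        simpa only [sup_eq_right.mpr hle, sup_eq_left.mpr (inf_le_left : (y ⊔ z) ⊓ a ≤ _)] using
          (hψ.2 _ _ _ _ hyz (hψ.1.refl ((y ⊔ z) ⊓ a))).1

/-- A congruence of a finite lattice is determined by the prime quotients `p' ⋖ p` with `p`
join-irreducible that it collapses. -/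
theorem IsLatCongr.rel_of_forall_supIrred {L : Type*} [Lattice L] [Finite L] {θ ψ : L → L → Prop}
    (hθ : IsLatCongr θ) (hψ : IsLatCongr ψ)
    (h : ∀ p p' : L, SupIrred p → p' ⋖ p → θ p' p → ψ p' p)
    {a b : L} (hab : θ a b) : ψ a b := by
  have key {a b : L} (hab : θ a b) : ψ (b ⊓ a) b := hθ.inf_rel_of_le hψ h hab b le_rfl
  have hba := key (hθ.1.symm hab)
  rw [inf_comm] at hba
  exact hψ.1.trans (hψ.1.symm hba) (key hab)

/-- For a finite nonempty lattice `L`, the number of congruences of `L` is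
at most `2` raised to the number of equivalence classes of join-irreducible elements under
`p ≈ q ↔ con(p_*, p) = con(q_*, q)`.  The number of such classes equals the number of
distinct congruences of the form `con(p_*, p)` with `p` join-irreducible and `p_* ⋖ p`
its (unique) lower cover, which is how it is expressed here. -/
theorem card_congr_le_pow_card_quotient
    {L : Type*} [Lattice L] [Fintype L] [Nonempty L] :
    Nat.card {θ : L → L → Prop // IsLatCongr θ} ≤
      2 ^ Set.ncard {c : L → L → Prop |
        ∃ p p' : L, SupIrred p ∧ p' ⋖ p ∧ c = latConGen p' p} := by
  set J := {c : L → L → Prop | ∃ p p' : L, SupIrred p ∧ p' ⋖ p ∧ c = latConGen p' p}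
  let f : {θ : L → L → Prop // IsLatCongr θ} → Set J := fun θ => {c | ∀ x y, c.1 x y → θ.1 x y}
  have hle (θ ψ : {θ : L → L → Prop // IsLatCongr θ}) (hf : f θ = f ψ) (a b : L)
      (hab : θ.1 a b) : ψ.1 a b := by
    refine θ.2.rel_of_forall_supIrred ψ.2 (fun p p' hp hcov hθ => ?_) hab
    have hmem : (⟨latConGen p' p, p, p', hp, hcov, rfl⟩ : J) ∈ f θ :=
      fun x y hxy => hxy θ.1 θ.2 hθ
    rw [hf] at hmem
    exact hmem p' p fun _ _ hr => hr
  have hinj : Function.Injective f := fun θ ψ hf =>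
    Subtype.ext <| funext₂ fun a b => propext ⟨hle θ ψ hf a b, hle ψ θ hf.symm a b⟩
  calc Nat.card {θ : L → L → Prop // IsLatCongr θ} ≤ Nat.card (Set J) :=
        Nat.card_le_card_of_injective f hinj
    _ = 2 ^ J.ncard := by
        rw [← Nat.card_coe_set_eq, Set, Nat.card_fun]
        simp
end

section
/- Let L be a finite lattice with n = |L| ≥ 1 elements. Then L has at most 2^(n−1) congruences, i.e. |Con(L)| ≤ 2^(n−1). -/
/-- The elements that are least in their class under `θ`. -/
def leastReps {L : Type*} [Lattice L] (θ : L → L → Prop) : Set L :=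
  {s | ∀ y, θ s y → s ≤ y}

namespace IsLatCongr

variable {L : Type*} [Lattice L] {θ : L → L → Prop}

theorem exists_mem_leastReps [Finite L] (h : IsLatCongr θ) (a : L) :
    ∃ m ∈ leastReps θ, θ a m ∧ m ≤ a := by
  obtain ⟨m, hma, hm⟩ := (Set.toFinite {x | θ a x}).exists_le_minimal (h.1.refl a)
  refine ⟨m, fun y hy => ?_, hm.prop, hma⟩
  have hinf : θ m (m ⊓ y) := by
    simpa using (h.2 m m m y (h.1.refl m) hy).2
  exact (hm.le_of_le (h.1.trans hm.prop hinf) inf_le_left).trans inf_le_right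

theorem le_of_mem_leastReps (h : IsLatCongr θ) {s a b : L} (hs : s ∈ leastReps θ)
    (hab : θ a b) (hsa : s ≤ a) : s ≤ b := by
  have hinf : θ s (s ⊓ b) := by
    simpa [inf_eq_left.mpr hsa] using (h.2 s s a b (h.1.refl s) hab).2
  exact (hs _ hinf).trans inf_le_right

/-- A congruence of a finite lattice is determined by the least elements of its classes. -/
theorem iff_forall_leastReps [Finite L] (h : IsLatCongr θ) {a b : L} :
    θ a b ↔ ∀ s ∈ leastReps θ, s ≤ a ↔ s ≤ b := by
  refine ⟨fun hab s hs => ⟨h.le_of_mem_leastReps hs hab,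
    h.le_of_mem_leastReps hs (h.1.symm hab)⟩, fun H => ?_⟩
  obtain ⟨m, hm, ham, hma⟩ := h.exists_mem_leastReps a
  obtain ⟨k, hk, hbk, hkb⟩ := h.exists_mem_leastReps b
  have hmk : m = k := le_antisymm
    (h.le_of_mem_leastReps hm hbk ((H m hm).1 hma))
    (h.le_of_mem_leastReps hk ham ((H k hk).2 hkb))
  exact h.1.trans ham (hmk ▸ h.1.symm hbk)

end IsLatCongr

/-- A finite lattice `L` with `n ≥ 1` elements has at most `2 ^ (n - 1)`
congruences. -/
theorem card_congr_le_two_pow_pred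
    {L : Type*} [Lattice L] [Fintype L] (hn : 1 ≤ Fintype.card L) :
    Nat.card {θ : L → L → Prop // IsLatCongr θ} ≤ 2 ^ (Fintype.card L - 1) := by
  classical
  have : Nonempty L := Fintype.card_pos_iff.mp hn
  let _ : OrderBot L := Fintype.toOrderBot L
  let f : {θ : L → L → Prop // IsLatCongr θ} → Set {x : L // x ≠ ⊥} :=
    fun θ => {x | x.1 ∈ leastReps θ.1}
  have hf : Function.Injective f := by
    intro θ ψ hθψ
    have hreps : leastReps θ.1 = leastReps ψ.1 := by
      ext x
      by_cases hx : x = ⊥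
      · simp [leastReps, hx]
      · exact Set.ext_iff.mp hθψ ⟨x, hx⟩
    ext a b
    rw [θ.2.iff_forall_leastReps, ψ.2.iff_forall_leastReps, hreps]
  calc
    _ ≤ Nat.card (Set {x : L // x ≠ ⊥}) := Nat.card_le_card_of_injective f hf
    _ = 2 ^ (Fintype.card L - 1) := by
      simp [Nat.card_eq_fintype_card, Fintype.card_set, Fintype.card_subtype_compl]
end

section
/- Let L be a finite nonempty distributive lattice. Then the lattice Con(L) of all congruences of L, ordered by inclusion, is a Boolean lattice: it is distributive and every element has a complement. -/
/-- The meet of two congruences in `Con(L)`: their intersection. -/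
def latConMeet {L : Type*} [Lattice L] (α β : L → L → Prop) : L → L → Prop :=
  fun x y => α x y ∧ β x y

/-- The join of two congruences in `Con(L)`: the smallest congruence containing their
union, i.e. the intersection of all congruences containing both. -/
def latConJoin {L : Type*} [Lattice L] (α β : L → L → Prop) : L → L → Prop :=
  fun x y => ∀ ρ : L → L → Prop, IsLatCongr ρ →
    (∀ u v, α u v → ρ u v) → (∀ u v, β u v → ρ u v) → ρ x y

/-- Clamping `u` to the interval `[a, b]` for all pairs `a ≤ b` related by `θ` and comparing the
results modulo `ρ` gives the relative pseudocomplement of `θ` in `ρ`. -/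
def latConImp {L : Type*} [Lattice L] (θ ρ : L → L → Prop) : L → L → Prop :=
  fun u v => ∀ a b, a ≤ b → θ a b → ρ ((u ⊔ a) ⊓ b) ((v ⊔ a) ⊓ b)

section

variable {L : Type*}

theorem isLatCongr_eq [Lattice L] : IsLatCongr (Eq : L → L → Prop) :=
  ⟨eq_equivalence, by rintro a _ c _ rfl rfl; exact ⟨rfl, rfl⟩⟩

theorem IsLatCongr.clamp [Lattice L] {θ : L → L → Prop} (hθ : IsLatCongr θ) {u v : L}
    (h : θ u v) (a b : L) : θ ((u ⊔ a) ⊓ b) ((v ⊔ a) ⊓ b) :=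
  (hθ.2 _ _ _ _ (hθ.2 _ _ _ _ h (hθ.1.refl a)).1 (hθ.1.refl b)).2

theorem IsLatCongr.clamp_left [Lattice L] {θ : L → L → Prop} (hθ : IsLatCongr θ) {a b : L}
    (h : θ a b) (u : L) : θ a ((u ⊔ a) ⊓ b) := by
  have key := (hθ.2 _ _ _ _ (hθ.1.refl (u ⊔ a)) h).2
  rwa [inf_eq_right.2 (le_sup_right : a ≤ u ⊔ a)] at key

theorem IsLatCongr.inf_sup [Lattice L] {θ : L → L → Prop} (hθ : IsLatCongr θ) {x y : L}
    (h : θ x y) : θ (x ⊓ y) (x ⊔ y) := by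
  have h₁ := hθ.2 _ _ _ _ h (hθ.1.refl y)
  rw [sup_idem, inf_idem] at h₁
  exact hθ.1.trans h₁.2 (hθ.1.symm h₁.1)

theorem IsLatCongr.latConImp [DistribLattice L] {ρ : L → L → Prop} (hρ : IsLatCongr ρ)
    (θ : L → L → Prop) : IsLatCongr (latConImp θ ρ) := by
  refine ⟨⟨fun _ _ _ _ _ => hρ.1.refl _, fun h a b hab hθ => hρ.1.symm (h a b hab hθ),
    fun h k a b hab hθ => hρ.1.trans (h a b hab hθ) (k a b hab hθ)⟩, fun u v w z h k => ?_⟩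
  have key a b (hab : a ≤ b) (hθ : θ a b) := hρ.2 _ _ _ _ (h a b hab hθ) (k a b hab hθ)
  refine ⟨fun a b hab hθ => ?_, fun a b hab hθ => ?_⟩
  · simpa only [← inf_sup_right, ← sup_sup_distrib_right] using (key a b hab hθ).1
  · simpa only [← inf_inf_distrib_right, ← sup_inf_right] using (key a b hab hθ).2

theorem le_latConImp [Lattice L] {θ ψ ρ : L → L → Prop} (hθ : IsLatCongr θ)
    (hψ : IsLatCongr ψ) (h : ∀ u v, latConMeet θ ψ u v → ρ u v) {u v : L} (huv : ψ u v) :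
    latConImp θ ρ u v := fun a b _ hab =>
  h _ _ ⟨hθ.1.trans (hθ.1.symm (hθ.clamp_left hab u)) (hθ.clamp_left hab v), hψ.clamp huv a b⟩

theorem of_latConImp [Lattice L] {θ ρ : L → L → Prop} (hθ : IsLatCongr θ) {x y : L}
    (hxy : θ x y) (h : latConImp θ ρ x y) : ρ x y := by
  have key := h (x ⊓ y) (x ⊔ y) inf_le_sup (hθ.inf_sup hxy)
  rwa [sup_inf_self, inf_sup_self, sup_eq_left.2 (inf_le_right : x ⊓ y ≤ y),
    inf_eq_left.2 (le_sup_right : y ≤ x ⊔ y)] at key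

theorem latConMeet_latConJoin [DistribLattice L] {θ ψ χ : L → L → Prop} (hθ : IsLatCongr θ)
    (hψ : IsLatCongr ψ) (hχ : IsLatCongr χ) :
    latConMeet θ (latConJoin ψ χ) = latConJoin (latConMeet θ ψ) (latConMeet θ χ) := by
  funext x y
  refine propext ⟨fun ⟨hxy, h⟩ ρ hρ h₁ h₂ => of_latConImp hθ hxy <|
    h _ (hρ.latConImp θ) (fun _ _ => le_latConImp hθ hψ h₁) fun _ _ => le_latConImp hθ hχ h₂,
    fun h => ⟨h θ hθ (fun _ _ k => k.1) fun _ _ k => k.1, fun ρ hρ h₁ h₂ =>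
      h ρ hρ (fun _ _ k => h₁ _ _ k.2) fun _ _ k => h₂ _ _ k.2⟩⟩

/-- A prime interval not collapsed by `θ` is collapsed by the pseudocomplement of `θ`. -/
theorem latConImp_eq_of_covBy [DistribLattice L] {θ : L → L → Prop} (hθ : IsLatCongr θ)
    {a b : L} (hab : a ⋖ b) (h : ¬ θ a b) : latConImp θ Eq a b := by
  intro c d hcd hθcd
  have hclamp := hθ.clamp hθcd a b
  have hmem (u : L) : (u ⊔ a) ⊓ b = a ∨ (u ⊔ a) ⊓ b = b :=
    hab.eq_or_eq (le_inf le_sup_right hab.le) inf_le_right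
  rcases hmem c with hc | hc
  · rcases hmem d with hd | hd
    · have hbd : b ⊓ d ≤ a := by
        rw [← hd]
        exact le_inf (inf_le_right.trans le_sup_left) inf_le_left
      refine le_antisymm (inf_le_inf_right d (sup_le_sup_right hab.le c)) ?_
      rw [inf_sup_right]
      exact sup_le (le_inf (hbd.trans le_sup_left) inf_le_right)
        (inf_le_inf_right d le_sup_right)
    · rw [hc, hd] at hclamp
      exact absurd hclamp h
  · have hb : b ≤ a ⊔ c := sup_comm c a ▸ inf_eq_right.1 hc
    rw [le_antisymm (sup_le_sup_right hab.le c) (sup_le hb le_sup_right)]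

theorem IsLatCongr.of_covBy [Lattice L] [LocallyFiniteOrder L] {ρ : L → L → Prop}
    (hρ : IsLatCongr ρ) (h : ∀ a b, a ⋖ b → ρ a b) (x y : L) : ρ x y := by
  have hle {a b : L} (hab : a ≤ b) : ρ a b := by
    induction le_iff_reflTransGen_covBy.1 hab with
    | refl => exact hρ.1.refl a
    | tail hac hcd ih => exact hρ.1.trans (ih (le_iff_reflTransGen_covBy.2 hac)) (h _ _ hcd)
  exact hρ.1.trans (hρ.1.symm (hle (inf_le_left : x ⊓ y ≤ x))) (hle inf_le_right)

theorem latConJoin_latConImp_eq [DistribLattice L] [LocallyFiniteOrder L] {θ : L → L → Prop}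
    (hθ : IsLatCongr θ) (x y : L) : latConJoin θ (latConImp θ Eq) x y := by
  intro ρ hρ h₁ h₂
  refine hρ.of_covBy (fun a b hab => ?_) x y
  by_cases h : θ a b
  · exact h₁ _ _ h
  · exact h₂ _ _ (latConImp_eq_of_covBy hθ hab h)

end

/-- For a finite nonempty distributive lattice `L`, the congruence lattice
`Con(L)` (ordered by inclusion, with meet = intersection and join = generated congruence)
is a Boolean lattice: it is distributive and every congruence has a complement (a
congruence meeting it in the equality relation and joining with it to the all
relation). -/
theorem conLat_distrib_and_complemented
    {L : Type*} [DistribLattice L] [Fintype L] [Nonempty L] :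
    (∀ θ ψ χ : L → L → Prop, IsLatCongr θ → IsLatCongr ψ → IsLatCongr χ →
      latConMeet θ (latConJoin ψ χ) = latConJoin (latConMeet θ ψ) (latConMeet θ χ)) ∧
    (∀ θ : L → L → Prop, IsLatCongr θ → ∃ ψ : L → L → Prop, IsLatCongr ψ ∧
      (∀ x y : L, latConMeet θ ψ x y ↔ x = y) ∧
      (∀ x y : L, latConJoin θ ψ x y)) := by
  let : LocallyFiniteOrder L :=
    LocallyFiniteOrder.ofFiniteIcc fun _ _ => Set.toFinite _
  refine ⟨fun θ ψ χ hθ hψ hχ => latConMeet_latConJoin hθ hψ hχ, fun θ hθ =>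
    ⟨latConImp θ Eq, isLatCongr_eq.latConImp θ, fun x y => ⟨fun h => of_latConImp hθ h.1 h.2, ?_⟩,
      latConJoin_latConImp_eq hθ⟩⟩
  rintro rfl
  exact ⟨hθ.1.refl x, (isLatCongr_eq.latConImp θ).1.refl x⟩
end
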